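/- arXiv:0910.5229 — 4 statements merged into one kernel-verified Lean document; each statement's English description precedes it below -/
import Mathlib

section
/- Let $p$ be a prime and $a \ge 1$. Then $\sum_{m=0}^{p^a - 1} (m+1)\binom{p^a - 1}{m}\binom{p^a + 1}{p^a - m} \equiv 1 \pmod{p}$. -/
/-- The binomial coefficients `C(p^a + 1, k)` with `2 ≤ k < p^a` vanish modulo `p`. -/
theorem Nat.Prime.dvd_choose_pow_add_one {p a k : ℕ} (hp : p.Prime) (hk : 2 ≤ k)
    (hka : k < p ^ a) : p ∣ (p ^ a + 1).choose k := by
  obtain ⟨j, rfl⟩ : ∃ j, k = j + 1 := ⟨k - 1, by omega⟩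
  rw [Nat.choose_succ_succ']
  exact dvd_add (hp.dvd_choose_pow (by omega) (by omega))
    (hp.dvd_choose_pow (by omega) (by omega))

/-- For a prime `p` and `a ≥ 1`,
`∑_{m=0}^{p^a - 1} (m+1) * C(p^a - 1, m) * C(p^a + 1, p^a - m) ≡ 1 (mod p)`. -/
theorem stmt6 (p a : ℕ) (hp : p.Prime) (ha : 1 ≤ a) :
    (∑ m ∈ Finset.range (p ^ a),
        (m + 1) * (p ^ a - 1).choose m * (p ^ a + 1).choose (p ^ a - m)) ≡ 1 [MOD p] := by
  have hpa : p ∣ p ^ a := dvd_pow_self p (by omega)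
  have hpos : 0 < p ^ a := pow_pos hp.pos a
  rw [← Finset.add_sum_erase _ _ (Finset.mem_range.mpr hpos)]
  have hrest : p ∣ ∑ m ∈ (Finset.range (p ^ a)).erase 0,
      (m + 1) * (p ^ a - 1).choose m * (p ^ a + 1).choose (p ^ a - m) := by
    refine Finset.dvd_sum fun m hm => ?_
    obtain ⟨hm0, hm⟩ := Finset.mem_erase.mp hm
    rw [Finset.mem_range] at hm
    by_cases hlast : m + 1 = p ^ a
    · rw [hlast, mul_assoc]
      exact dvd_mul_of_dvd_left hpa _
    · exact dvd_mul_of_dvd_right (hp.dvd_choose_pow_add_one (by omega) (by omega)) _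
  have hfirst : (0 + 1) * (p ^ a - 1).choose 0 * (p ^ a + 1).choose (p ^ a - 0) ≡ 1 [MOD p] := by
    simpa using (Nat.modEq_zero_iff_dvd.mpr hpa).add_right 1
  exact hfirst.add (Nat.modEq_zero_iff_dvd.mpr hrest)
end

section
/- Let $p$ be a prime, $a \ge 1$, and let $s$ be an integer with $1 \le s < p^a$. Then $p$ divides $\sum_{m=s-1}^{p^a - 1} (m+1)\binom{p^a - s}{m - s + 1}\binom{p^a}{m + 1}$. -/
/-- For a prime `p`, `a ≥ 1` and `1 ≤ s < p^a`,
`p` divides `∑_{m=s-1}^{p^a - 1} (m+1) * C(p^a - s, m - s + 1) * C(p^a, m + 1)`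
(here `m - s + 1` means the integer `m + 1 - s`, which is nonnegative since `m ≥ s - 1`). -/
theorem stmt8 (p a : ℕ) (hp : p.Prime) (ha : 1 ≤ a) (s : ℕ) (hs1 : 1 ≤ s) (hs2 : s < p ^ a) :
    p ∣ ∑ m ∈ Finset.Icc (s - 1) (p ^ a - 1),
        (m + 1) * (p ^ a - s).choose (m + 1 - s) * (p ^ a).choose (m + 1) := by
  refine Finset.dvd_sum fun m _ => ?_
  have h : p ^ a * (p ^ a - 1).choose m = (p ^ a).choose (m + 1) * (m + 1) := by
    have h := Nat.add_one_mul_choose_eq (p ^ a - 1) m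
    rwa [Nat.sub_add_cancel (Nat.pow_pos hp.pos)] at h
  rw [mul_right_comm, mul_comm (m + 1), ← h, mul_assoc]
  exact (dvd_pow_self p (by omega)).mul_right _
end

section
/- Let $p$ be a prime, $a \ge 1$, and let $s, t$ be integers with $1 \le t \le s < p^a$. Then, as integers, $\sum_{m=t}^{p^a - 1} (m+1)\binom{p^a - 1 - t}{m - t}\binom{p^a - s + t + 1}{m + 1} \; - \; \sum_{m=t-1}^{p^a - 1} (m+1)\binom{p^a - t}{m - t + 1}\binom{p^a - s + t}{m + 1} \; = \; \binom{2p^a - s - 1}{p^a - 1}$. -/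
open Finset in
/-- Vandermonde's convolution, with the sum restricted to its nonzero terms. -/
theorem sum_Icc_choose_sub_mul_choose {n t : ℕ} (h : t ≤ n) (M : ℕ) :
    ∑ m ∈ Icc t n, (n - t).choose (m - t) * M.choose m = (M + (n - t)).choose n := by
  rw [Nat.add_choose_eq, Nat.sum_antidiagonal_eq_sum_range_succ
    (fun i j => M.choose i * (n - t).choose j)]
  refine sum_subset_zero_on_sdiff (fun m hm => ?_) (fun m hm => ?_) (fun m hm => ?_)
  · simp only [mem_Icc] at hm
    simp only [mem_range]
    omega
  · simp only [mem_sdiff, mem_range, mem_Icc] at hm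
    rw [Nat.choose_eq_zero_of_lt (by omega : n - t < n - m), mul_zero]
  · simp only [mem_Icc] at hm
    rw [mul_comm, Nat.choose_symm_of_eq_add (by omega : n - t = (m - t) + (n - m))]

open Finset in
theorem sum_Icc_succ_mul_choose_sub_mul_choose_succ {n t : ℕ} (h : t ≤ n) (M : ℕ) :
    ∑ m ∈ Icc t n, ((m + 1 : ℤ) * (n - t).choose (m - t) * (M + 1).choose (m + 1)) =
      (M + 1) * (M + (n - t)).choose n := by
  rw [← sum_Icc_choose_sub_mul_choose h M, Nat.cast_sum, mul_sum]
  refine sum_congr rfl fun m _ => ?_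
  have key : ((M : ℤ) + 1) * M.choose m = (M + 1).choose (m + 1) * (m + 1) := by
    exact_mod_cast Nat.add_one_mul_choose_eq M m
  push_cast
  linear_combination (-((n - t).choose (m - t) : ℤ)) * key

/-- For a prime `p`, `a ≥ 1` and `1 ≤ t ≤ s < p^a`, as integers,
`A_{s,t} - A_{s,t-1} = C(2p^a - s - 1, p^a - 1)`, where
`A_{s,t} = ∑_{m=t}^{p^a-1} (m+1) C(p^a-1-t, m-t) C(p^a-s+t+1, m+1)` and
`A_{s,t-1} = ∑_{m=t-1}^{p^a-1} (m+1) C(p^a-t, m-(t-1)) C(p^a-s+t, m+1)`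
(the index `m - (t-1)` is written `m + 1 - t`, nonnegative since `m ≥ t - 1`). -/
theorem stmt9 (p a : ℕ) (hp : p.Prime) (ha : 1 ≤ a) (s t : ℕ)
    (ht : 1 ≤ t) (hts : t ≤ s) (hs : s < p ^ a) :
    (∑ m ∈ Finset.Icc t (p ^ a - 1),
        ((m + 1 : ℤ) * (p ^ a - 1 - t).choose (m - t) * (p ^ a - s + t + 1).choose (m + 1)))
      - (∑ m ∈ Finset.Icc (t - 1) (p ^ a - 1),
        ((m + 1 : ℤ) * (p ^ a - t).choose (m + 1 - t) * (p ^ a - s + t).choose (m + 1)))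
      = (2 * p ^ a - s - 1).choose (p ^ a - 1) := by
  have h₁ := sum_Icc_succ_mul_choose_sub_mul_choose_succ
    (by omega : t ≤ p ^ a - 1) (p ^ a - s + t)
  have h₂ := sum_Icc_succ_mul_choose_sub_mul_choose_succ
    (by omega : t - 1 ≤ p ^ a - 1) (p ^ a - s + t - 1)
  rw [show p ^ a - s + t - 1 + 1 = p ^ a - s + t by omega,
    show p ^ a - 1 - (t - 1) = p ^ a - t by omega,
    show p ^ a - s + t - 1 + (p ^ a - t) = 2 * p ^ a - s - 1 by omega] at h₂
  rw [show p ^ a - s + t + (p ^ a - 1 - t) = 2 * p ^ a - s - 1 by omega] at h₁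
  have h₃ : ((p ^ a - s + t - 1 : ℕ) : ℤ) + 1 = (p ^ a - s + t : ℕ) := by
    exact_mod_cast (by omega : p ^ a - s + t - 1 + 1 = p ^ a - s + t)
  have h₄ (m : ℕ) : m + 1 - t = m - (t - 1) := by omega
  simp only [h₄]
  rw [h₁, h₂, h₃]
  ring
end

section
/- Let $p$ be a prime, $a \ge 1$, and let $s$ be an integer with $1 \le s < p^a$. Then $p$ divides $\binom{2p^a - s - 1}{p^a - 1}$. -/
/-- A carry at position `a` in the base-`p` addition of `n` and `k` makes `p` divide
`(n + k).choose k`. -/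
theorem Nat.Prime.dvd_add_choose_of_pow_le_mod_add_mod {p a n k : ℕ} (hp : p.Prime)
    (h : p ^ a ≤ k % p ^ a + n % p ^ a) : p ∣ (n + k).choose k := by
  have ha : a ≠ 0 := by
    rintro rfl
    simp [Nat.mod_one] at h
  have hle : p ^ a ≤ n + k := by
    have := Nat.mod_le k (p ^ a)
    have := Nat.mod_le n (p ^ a)
    omega
  have hlog : a ≤ Nat.log p (n + k) := Nat.le_log_of_pow_le hp.one_lt hle
  apply Nat.dvd_of_factorization_pos
  rw [Nat.factorization_choose' hp (Nat.lt_succ_self _)]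
  refine Finset.card_ne_zero_of_mem (a := a) ?_
  simp only [Finset.mem_filter, Finset.mem_Ico]
  exact ⟨by omega, h⟩

/-- For a prime `p`, `a ≥ 1` and `1 ≤ s < p^a`, `p` divides `C(2p^a - s - 1, p^a - 1)`. -/
theorem stmt10 (p a : ℕ) (hp : p.Prime) (ha : 1 ≤ a) (s : ℕ) (hs1 : 1 ≤ s) (hs2 : s < p ^ a) :
    p ∣ (2 * p ^ a - s - 1).choose (p ^ a - 1) := by
  have hn : 2 * p ^ a - s - 1 = (p ^ a - s) + (p ^ a - 1) := by omega
  rw [hn]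
  apply hp.dvd_add_choose_of_pow_le_mod_add_mod (a := a)
  rw [Nat.mod_eq_of_lt (by omega), Nat.mod_eq_of_lt (by omega)]
  omega
end
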